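/- Let f: Ω → ℝ be α-Hölder with λ > 0 and strictly positive α-Hölder h satisfying L_f h = λ h; set f̄ = f + log h − log(h∘σ) − log λ and let μ_f̄ be the unique Borel probability measure with L_{f̄}* μ_f̄ = μ_f̄. Then μ_f̄ is the unique equilibrium state for f: it is the unique shift-invariant Borel probability measure μ satisfying h^s(μ) + ∫_Ω f dμ = sup { h^s(η) + ∫_Ω f dη : η shift-invariant Borel probability measure }, and this supremum equals log λ. -/

import Mathlib

open MeasureTheory Filter
open scoped Classical

noncomputable section

namespace Paper

variable {A : Type*} [MetricSpace A] [CompactSpace A] [MeasurableSpace A] [BorelSpace A]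

/-- The left shift `σ` on `Ω = Aᴺ`. -/
def shift (x : ℕ → A) : ℕ → A := fun n => x (n + 1)

/-- Prepend a symbol: `cons a x = (a, x₀, x₁, …)`. -/
def cons (a : A) (x : ℕ → A) : ℕ → A := fun n =>
  match n with
  | 0 => a
  | n + 1 => x n

/-- The metric `d_Ω` on `Ω`. -/
def dOmega (x y : ℕ → A) : ℝ :=
  ∑' n : ℕ, (1 / 2 : ℝ) ^ (n + 1) * (dist (x n) (y n) / (1 + dist (x n) (y n)))

/-- `f` is `α`-Hölder with respect to `d_Ω`. -/
def IsHolder (α : ℝ) (f : (ℕ → A) → ℝ) : Prop :=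
  ∃ C : ℝ, 0 ≤ C ∧ ∀ x y, |f x - f y| ≤ C * dOmega x y ^ α

/-- The Ruelle transfer operator with a priori measure `p`. -/
def ruelle (p : Measure A) (f φ : (ℕ → A) → ℝ) : (ℕ → A) → ℝ :=
  fun x => ∫ a, Real.exp (f (cons a x)) * φ (cons a x) ∂p

/-- The normalized potential `f̄ = f + log h - log (h ∘ σ) - log λ`. -/
def fbar (f h : (ℕ → A) → ℝ) (lam : ℝ) : (ℕ → A) → ℝ :=
  fun x => f x + Real.log (h x) - Real.log (h (shift x)) - Real.log lam

/-- Projection on the first `n` coordinates. -/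
def proj (n : ℕ) (x : ℕ → A) : Fin n → A := fun i => x i

/-- Relative entropy `H(μ|ν)` of two measures, with value `+∞` unless
`μ ≪ ν` and the entropy integral is finite. -/
def relEnt {X : Type*} [MeasurableSpace X] (μ ν : Measure X) : EReal :=
  if μ ≪ ν ∧ Integrable (fun x => Real.log (μ.rnDeriv ν x).toReal) μ then
    ((∫ x, Real.log (μ.rnDeriv ν x).toReal ∂μ : ℝ) : EReal)
  else ⊤

/-- Relative entropy `H_{Λ_n}(μ|ν)` on the σ-algebra of the first `n` coordinates. -/
def relEntN (n : ℕ) (μ ν : Measure (ℕ → A)) : EReal :=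
  relEnt (μ.map (proj n)) (ν.map (proj n))

/-- The entropy `H_{Λ_n}(μ) = -H_{Λ_n}(μ | pᴺ)` relative to the a priori measure `p`. -/
def finEnt (p : Measure A) (μ : Measure (ℕ → A)) (n : ℕ) : EReal :=
  - relEnt (μ.map (proj n)) (Measure.pi fun _ : Fin n => p)

/-- The specific entropy `h^s(μ) = lim_n H_{Λ_n}(μ)/n` (defined as a `limsup`,
which coincides with the limit whenever the latter exists). -/
def specEnt (p : Measure A) (μ : Measure (ℕ → A)) : EReal :=
  Filter.atTop.limsup fun n : ℕ => ((n : ℝ)⁻¹ : EReal) * finEnt p μ n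

/-- Birkhoff sum `S_n(f)`. -/
def birkhoff (n : ℕ) (f : (ℕ → A) → ℝ) (x : ℕ → A) : ℝ :=
  ∑ i ∈ Finset.range n, f (shift^[i] x)

/-- The configuration `x_{Λ_n} y_{Λ_n^c}`. -/
def concatAt (n : ℕ) (x y : ℕ → A) : ℕ → A := fun i => if i < n then x i else y i

/-- Concatenation of a finite word with a configuration. -/
def wordCons (n : ℕ) (a : Fin n → A) (x : ℕ → A) : ℕ → A :=
  fun i => if h : i < n then a ⟨i, h⟩ else x (i - n)
set_option linter.unusedSectionVars false

theorem continuous_cons : Continuous fun q : A × (ℕ → A) => cons q.1 q.2 := by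
  refine continuous_pi fun n => ?_
  cases n with
  | zero => exact continuous_fst
  | succ n => exact (continuous_apply n).comp continuous_snd

theorem continuous_shift : Continuous (shift : (ℕ → A) → ℕ → A) :=
  continuous_pi fun n => continuous_apply (n + 1)

theorem shift_cons (a : A) (x : ℕ → A) : shift (cons a x) = x := rfl

theorem continuous_wordCons (n : ℕ) :
    Continuous fun q : (Fin n → A) × (ℕ → A) => wordCons n q.1 q.2 := by
  refine continuous_pi fun i => ?_
  by_cases hi : i < n
  · simp only [wordCons, hi, dite_true]
    exact (continuous_apply _).comp continuous_fst
  · simp only [wordCons, hi, dite_false]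
    exact (continuous_apply _).comp continuous_snd

theorem continuous_proj (n : ℕ) : Continuous (proj n : (ℕ → A) → Fin n → A) :=
  continuous_pi fun i => continuous_apply (i : ℕ)

theorem proj_wordCons (n : ℕ) (a : Fin n → A) (x : ℕ → A) : proj n (wordCons n a x) = a := by
  ext i
  simp [proj, wordCons]

theorem wordCons_proj_apply (n : ℕ) (x y : ℕ → A) {i : ℕ} (hi : i < n) :
    wordCons n (proj n x) y i = x i := by
  simp [wordCons, proj, hi]

theorem wordCons_zero (a : Fin 0 → A) (x : ℕ → A) : wordCons 0 a x = x := by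
  ext i
  simp [wordCons]

theorem wordCons_succ (n : ℕ) (a : Fin (n + 1) → A) (x : ℕ → A) :
    wordCons (n + 1) a x = cons (a 0) (wordCons n (fun i => a i.succ) x) := by
  ext i
  cases i with
  | zero => simp [wordCons, cons]
  | succ i => simp [wordCons, cons]

theorem shift_iterate_apply (i : ℕ) (x : ℕ → A) (k : ℕ) : shift^[i] x k = x (k + i) := by
  induction i generalizing k with
  | zero => rfl
  | succ i ih =>
    rw [Function.iterate_succ_apply']
    simp only [shift, ih]
    congr 1
    omega

theorem continuous_birkhoff (n : ℕ) {F : (ℕ → A) → ℝ} (hF : Continuous F) :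
    Continuous (birkhoff n F) :=
  continuous_finsetSum _ fun i _ => hF.comp (continuous_shift.iterate i)

theorem birkhoff_succ_cons (n : ℕ) (F : (ℕ → A) → ℝ) (a : A) (x : ℕ → A) :
    birkhoff (n + 1) F (cons a x) = F (cons a x) + birkhoff n F x := by
  simp [birkhoff, Finset.sum_range_succ', shift_cons, add_comm]

theorem _root_.Continuous.integrable_of_compactSpace {X : Type*} [TopologicalSpace X]
    [CompactSpace X] [MeasurableSpace X] [OpensMeasurableSpace X] {μ : Measure X}
    [IsFiniteMeasure μ] {u : X → ℝ} (hu : Continuous u) : Integrable u μ :=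
  hu.integrable_of_hasCompactSupport (HasCompactSupport.of_compactSpace u)

theorem _root_.Continuous.integral_of_compactSpace {X Y : Type*} [TopologicalSpace X]
    [FirstCountableTopology X] [LocallyCompactSpace X] [TopologicalSpace Y] [CompactSpace Y]
    [MeasurableSpace Y] [OpensMeasurableSpace Y] {μ : Measure Y} [IsFiniteMeasure μ]
    {u : X → Y → ℝ} (hu : Continuous (Function.uncurry u)) :
    Continuous fun x => ∫ y, u x y ∂μ := by
  simpa using continuous_parametric_integral_of_continuous (μ := μ) hu isCompact_univ

theorem exists_bound {F : (ℕ → A) → ℝ} (hF : Continuous F) : ∃ M : ℝ, 0 ≤ M ∧ ∀ x, |F x| ≤ M := by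
  obtain ⟨M, hM⟩ := isCompact_univ.exists_bound_of_continuousOn (f := F) hF.continuousOn
  exact ⟨max M 0, le_max_right _ _, fun x => (hM x trivial).trans (le_max_left _ _)⟩

/-- A Hölder function is continuous for the product topology. -/
theorem IsHolder.continuous {α : ℝ} (hα : 0 < α) {f : (ℕ → A) → ℝ} (hf : IsHolder α f) :
    Continuous f := by
  obtain ⟨C, -, hC⟩ := hf
  rw [continuous_iff_continuousAt]
  intro x
  have hd : Continuous fun y => dOmega y x := by
    refine continuous_tsum (u := fun n => (1 / 2 : ℝ) ^ (n + 1)) (fun n => ?_) ?_ fun n y => ?_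
    · have hc : Continuous fun y : ℕ → A => dist (y n) (x n) :=
        (continuous_apply n).dist continuous_const
      exact continuous_const.mul (hc.div (continuous_const.add hc) fun y => by positivity)
    · exact (summable_nat_add_iff 1).2 (summable_geometric_of_lt_one (by norm_num) (by norm_num))
    · have h0 : (0 : ℝ) ≤ dist (y n) (x n) := dist_nonneg
      rw [Real.norm_of_nonneg (by positivity)]
      refine mul_le_of_le_one_right (by positivity) ?_
      rw [div_le_one (by positivity)]
      linarith
  have h0 : dOmega x x = 0 := by simp [dOmega]
  have hlim : Tendsto (fun y => C * dOmega y x ^ α) (nhds x) (nhds 0) := by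
    have := ((hd.rpow_const fun _ => Or.inr hα.le).const_mul C).tendsto x
    simpa [h0, Real.zero_rpow hα.ne'] using this
  rw [ContinuousAt, tendsto_iff_dist_tendsto_zero]
  exact squeeze_zero (fun _ => dist_nonneg) (fun y => hC y x) hlim

/-- Uniform continuity in terms of finitely many coordinates. -/
theorem exists_agree_imp_lt {F : (ℕ → A) → ℝ} (hF : Continuous F) {ε : ℝ} (hε : 0 < ε) :
    ∃ N : ℕ, ∀ x z : ℕ → A, (∀ i < N, x i = z i) → |F x - F z| < ε := by
  by_contra! hcon
  let t : ℕ → Set ((ℕ → A) × (ℕ → A)) := fun N =>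
    {q | (∀ i < N, q.1 i = q.2 i) ∧ ε ≤ |F q.1 - F q.2|}
  have hclosed : ∀ N, IsClosed (t N) := fun N => by
    refine IsClosed.inter (s₁ := {q : (ℕ → A) × (ℕ → A) | ∀ i < N, q.1 i = q.2 i}) ?_ ?_
    · simp only [Set.ofPred_forall]
      exact isClosed_iInter fun i => isClosed_iInter fun _ =>
        isClosed_eq (by fun_prop) (by fun_prop)
    · exact isClosed_le continuous_const
        ((hF.comp continuous_fst).sub (hF.comp continuous_snd)).abs
  obtain ⟨q, hq⟩ := IsCompact.nonempty_iInter_of_sequence_nonempty_isCompact_isClosed t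
    (fun N q hq => ⟨fun i hi => hq.1 i (by omega), hq.2⟩)
    (fun N => by obtain ⟨x, z, h1, h2⟩ := hcon N; exact ⟨(x, z), h1, h2⟩)
    (hclosed 0).isCompact hclosed
  rw [Set.mem_iInter] at hq
  have heq : q.1 = q.2 := funext fun i => (hq (i + 1)).1 i (by omega)
  have := (hq 0).2
  rw [heq, sub_self, abs_zero] at this
  linarith

/-- Birkhoff sums of length `n` depend on the coordinates beyond `n` only up to `o(n)`. -/
theorem exists_birkhoff_sub_le {F : (ℕ → A) → ℝ} (hF : Continuous F) {ε : ℝ} (hε : 0 < ε) :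
    ∃ K : ℝ, ∀ (n : ℕ) (x z : ℕ → A), (∀ i < n, x i = z i) →
      |birkhoff n F x - birkhoff n F z| ≤ n * ε + K := by
  obtain ⟨N, hN⟩ := exists_agree_imp_lt hF hε
  obtain ⟨M, hM0, hM⟩ := exists_bound hF
  refine ⟨N * (2 * M), fun n x z hxz => ?_⟩
  have hterm : ∀ i ∈ Finset.range n, |F (shift^[i] x) - F (shift^[i] z)| ≤
      ε + if n < i + N then 2 * M else 0 := by
    intro i hi
    split_ifs with hiN
    · have h1 := abs_sub (F (shift^[i] x)) (F (shift^[i] z))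
      linarith [hM (shift^[i] x), hM (shift^[i] z)]
    · rw [add_zero]
      refine (hN _ _ fun k hk => ?_).le
      rw [shift_iterate_apply, shift_iterate_apply]
      exact hxz _ (by omega)
  have hcard : (((Finset.range n).filter fun i => n < i + N).card : ℝ) ≤ N := by
    have hsub : ((Finset.range n).filter fun i => n < i + N) ⊆ Finset.Ico (n - N) n := by
      intro i hi
      simp only [Finset.mem_filter, Finset.mem_range, Finset.mem_Ico] at hi ⊢
      omega
    have := Finset.card_le_card hsub
    rw [Nat.card_Ico] at this
    exact_mod_cast this.trans (by omega)
  calc |birkhoff n F x - birkhoff n F z|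
      ≤ ∑ i ∈ Finset.range n, |F (shift^[i] x) - F (shift^[i] z)| := by
        rw [birkhoff, birkhoff, ← Finset.sum_sub_distrib]
        exact Finset.abs_sum_le_sum_abs _ _
    _ ≤ ∑ i ∈ Finset.range n, (ε + if n < i + N then 2 * M else 0) := Finset.sum_le_sum hterm
    _ = n * ε + ((Finset.range n).filter fun i => n < i + N).card * (2 * M) := by
        rw [Finset.sum_add_distrib, ← Finset.sum_filter]
        simp
    _ ≤ n * ε + N * (2 * M) := by gcongr

theorem integral_birkhoff {η : Measure (ℕ → A)} [IsProbabilityMeasure η]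
    (hη : η.map shift = η) {F : (ℕ → A) → ℝ} (hF : Continuous F) (n : ℕ) :
    ∫ x, birkhoff n F x ∂η = n * ∫ x, F x ∂η := by
  have hmp : MeasurePreserving shift η η := ⟨continuous_shift.measurable, hη⟩
  have hi : ∀ i, ∫ x, F (shift^[i] x) ∂η = ∫ x, F x ∂η := fun i => by
    conv_rhs => rw [← (hmp.iterate i).map_eq]
    exact (integral_map (hmp.iterate i).measurable.aemeasurable
      hF.aestronglyMeasurable).symm
  simp only [birkhoff]
  rw [integral_finsetSum]
  · simp [hi]
  · exact fun i _ => (hF.comp (continuous_shift.iterate i)).integrable_of_compactSpace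

/-- Gibbs' inequality: the relative entropy dominates the mean of any normalized log-density. -/
theorem integral_le_relEnt {X : Type*} [MeasurableSpace X] {η ν : Measure X}
    [IsProbabilityMeasure η] [IsProbabilityMeasure ν] {u : X → ℝ} (huη : Integrable u η)
    (huν : Integrable (fun x => Real.exp (u x)) ν) (hu : ∫ x, Real.exp (u x) ∂ν = 1) :
    ((∫ x, u x ∂η : ℝ) : EReal) ≤ relEnt η ν := by
  unfold relEnt
  split_ifs with hac
  · have := isProbabilityMeasure_tilted huν
    have h1 := integral_llr_tilted_right hac.1 huη huν hac.2
    have h2 := InformationTheory.toReal_klDiv_of_measure_eq (μ := η) (ν := ν.tilted u)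
      (hac.1.trans (absolutelyContinuous_tilted huν)) (by simp)
    rw [h1, hu, Real.log_one] at h2
    have h3 : 0 ≤ (InformationTheory.klDiv η (ν.tilted u)).toReal := ENNReal.toReal_nonneg
    rw [h2] at h3
    simp only [llr] at h3
    exact_mod_cast (by linarith)
  · exact le_top

theorem relEnt_tilted {X : Type*} [MeasurableSpace X] {ν : Measure X} [IsProbabilityMeasure ν]
    {u : X → ℝ} (huν : Integrable (fun x => Real.exp (u x)) ν)
    (hu : ∫ x, Real.exp (u x) ∂ν = 1) (hi : Integrable u (ν.tilted u)) :
    relEnt (ν.tilted u) ν = ((∫ x, u x ∂(ν.tilted u) : ℝ) : EReal) := by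
  have hae : (fun x => Real.log ((ν.tilted u).rnDeriv ν x).toReal) =ᵐ[ν.tilted u] u := by
    filter_upwards [(tilted_absolutelyContinuous ν u).ae_le (log_rnDeriv_tilted_left_self huν)]
      with x hx
    rw [hx, hu, Real.log_one, sub_zero]
  rw [relEnt, if_pos ⟨tilted_absolutelyContinuous ν u, hi.congr hae.symm⟩, integral_congr_ae hae]

theorem specEnt_le_of_finEnt_le {p : Measure A} {η : Measure (ℕ → A)} {c : ℝ}
    (hc : ∀ ε > 0, ∃ K : ℝ, ∀ n : ℕ, finEnt p η n ≤ ((n * (c + ε) + K : ℝ) : EReal)) :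
    specEnt p η ≤ (c : EReal) := by
  rw [← EReal.le_of_forall_lt_iff_le]
  intro z hz
  have hz' : c < z := by exact_mod_cast hz
  obtain ⟨K, hK⟩ := hc ((z - c) / 2) (by linarith)
  have hlim : Tendsto (fun n : ℕ => (c + (z - c) / 2) + K / n) atTop
      (nhds ((c + (z - c) / 2) + 0)) :=
    tendsto_const_nhds.add (tendsto_const_div_atTop_nhds_zero_nat K)
  refine limsup_le_of_le (by isBoundedDefault) ?_
  filter_upwards [hlim.eventually_lt_const (by linarith : c + (z - c) / 2 + 0 < z),
    eventually_gt_atTop 0] with n hn hn0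
  have hn0' : (0 : ℝ) < n := by exact_mod_cast hn0
  refine (mul_le_mul_of_nonneg_left (hK n) ?_).trans ?_
  · rw [← EReal.coe_inv]; exact_mod_cast (inv_pos.2 hn0').le
  · rw [← EReal.coe_inv, ← EReal.coe_mul, EReal.coe_le_coe_iff]
    refine le_of_eq_of_le ?_ hn.le
    field_simp

theorem le_specEnt_of_le_finEnt {p : Measure A} {η : Measure (ℕ → A)} {c : ℝ}
    (hc : ∀ ε > 0, ∃ K : ℝ, ∀ n : ℕ, ((n * (c - ε) - K : ℝ) : EReal) ≤ finEnt p η n) :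
    (c : EReal) ≤ specEnt p η := by
  rw [← EReal.ge_of_forall_gt_iff_ge]
  intro z hz
  have hz' : z < c := by exact_mod_cast hz
  obtain ⟨K, hK⟩ := hc ((c - z) / 2) (by linarith)
  have hlim : Tendsto (fun n : ℕ => (c - (c - z) / 2) - K / n) atTop
      (nhds ((c - (c - z) / 2) - 0)) :=
    tendsto_const_nhds.sub (tendsto_const_div_atTop_nhds_zero_nat K)
  refine le_limsup_of_frequently_le (Eventually.frequently ?_) (by isBoundedDefault)
  filter_upwards [hlim.eventually_const_lt (by linarith : z < c - (c - z) / 2 - 0),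
    eventually_gt_atTop 0] with n hn hn0
  have hn0' : (0 : ℝ) < n := by exact_mod_cast hn0
  refine le_trans ?_ (mul_le_mul_of_nonneg_left (hK n) ?_)
  · rw [← EReal.coe_inv, ← EReal.coe_mul, EReal.coe_le_coe_iff]
    refine le_of_le_of_eq hn.le ?_
    field_simp
  · rw [← EReal.coe_inv]; exact_mod_cast (inv_pos.2 hn0').le

theorem continuous_ruelle {p : Measure A} [IsProbabilityMeasure p] {F φ : (ℕ → A) → ℝ}
    (hF : Continuous F) (hφ : Continuous φ) : Continuous (ruelle p F φ) := by
  have hc : Continuous fun q : (ℕ → A) × A => cons q.2 q.1 := continuous_cons.comp continuous_swap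
  exact Continuous.integral_of_compactSpace (((hF.comp hc).rexp).mul (hφ.comp hc))

theorem continuous_ruelle_iterate {p : Measure A} [IsProbabilityMeasure p] {F φ : (ℕ → A) → ℝ}
    (hF : Continuous F) (hφ : Continuous φ) (n : ℕ) : Continuous ((ruelle p F)^[n] φ) := by
  induction n generalizing φ with
  | zero => exact hφ
  | succ n ih => exact ih (continuous_ruelle hF hφ)

/-- The iterates of the Ruelle operator as integrals over words. -/
theorem ruelle_iterate_apply {p : Measure A} [IsProbabilityMeasure p] {F φ : (ℕ → A) → ℝ}
    (hF : Continuous F) (hφ : Continuous φ) (n : ℕ) (y : ℕ → A) :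
    (ruelle p F)^[n] φ y = ∫ a, Real.exp (birkhoff n F (wordCons n a y)) * φ (wordCons n a y)
      ∂(Measure.pi fun _ : Fin n => p) := by
  induction n generalizing φ with
  | zero => simp [wordCons_zero, birkhoff]
  | succ n ih =>
    rw [Function.iterate_succ_apply, ih (continuous_ruelle hF hφ)]
    have hmp := measurePreserving_piFinSuccAbove (fun _ : Fin (n + 1) => p) 0
    let G : A × (Fin n → A) → ℝ := fun q =>
      Real.exp (birkhoff (n + 1) F (cons q.1 (wordCons n q.2 y))) * φ (cons q.1 (wordCons n q.2 y))
    have hw : Continuous fun q : A × (Fin n → A) => cons q.1 (wordCons n q.2 y) :=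
      continuous_cons.comp (continuous_fst.prodMk
        ((continuous_wordCons n).comp (continuous_snd.prodMk continuous_const)))
    have hG : Continuous G := ((continuous_birkhoff _ hF).comp hw).rexp.mul (hφ.comp hw)
    have hL : ∀ a : Fin (n + 1) → A,
        Real.exp (birkhoff (n + 1) F (wordCons (n + 1) a y)) * φ (wordCons (n + 1) a y) =
          G (MeasurableEquiv.piFinSuccAbove (fun _ => A) 0 a) := by
      intro a
      rw [wordCons_succ]
      rfl
    simp only [hL]
    rw [hmp.integral_comp' G, integral_prod_symm G hG.integrable_of_compactSpace]
    refine integral_congr_ae (ae_of_all _ fun a => ?_)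
    simp only [ruelle, G, birkhoff_succ_cons, Real.exp_add]
    rw [← integral_const_mul]
    refine integral_congr_ae (ae_of_all _ fun b => ?_)
    ring

theorem integral_exp_birkhoff_wordCons {p : Measure A} [IsProbabilityMeasure p]
    {F : (ℕ → A) → ℝ} (hF : Continuous F) (hn : ∀ x, ∫ a, Real.exp (F (cons a x)) ∂p = 1)
    (n : ℕ) (y : ℕ → A) :
    ∫ a, Real.exp (birkhoff n F (wordCons n a y)) ∂(Measure.pi fun _ : Fin n => p) = 1 := by
  have h1 : ruelle p F (fun _ => 1) = fun _ => 1 := by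
    ext x
    simp [ruelle, hn]
  have h2 := ruelle_iterate_apply (p := p) hF (continuous_const (y := (1 : ℝ))) n y
  rw [Function.iterate_fixed h1] at h2
  simpa using h2.symm

/-- The variational inequality for a normalized continuous potential. -/
theorem specEnt_le_neg_integral {p : Measure A} [IsProbabilityMeasure p]
    {F : (ℕ → A) → ℝ} (hF : Continuous F) (hn : ∀ x, ∫ a, Real.exp (F (cons a x)) ∂p = 1)
    {η : Measure (ℕ → A)} [IsProbabilityMeasure η] (hη : η.map shift = η) :
    specEnt p η ≤ ((-∫ x, F x ∂η : ℝ) : EReal) := by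
  have : Nonempty A := nonempty_of_isProbabilityMeasure p
  let y : ℕ → A := fun _ => Classical.arbitrary A
  refine specEnt_le_of_finEnt_le fun ε hε => ?_
  obtain ⟨K, hK⟩ := exists_birkhoff_sub_le hF hε
  refine ⟨K, fun n => ?_⟩
  have hproj : Measurable (proj n : (ℕ → A) → Fin n → A) := (continuous_proj n).measurable
  have : IsProbabilityMeasure (η.map (proj n)) :=
    Measure.isProbabilityMeasure_map hproj.aemeasurable
  have hw : Continuous fun a : Fin n → A => wordCons n a y :=
    (continuous_wordCons n).comp (continuous_id.prodMk (continuous_const (y := y)))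
  have hu : Continuous fun a : Fin n → A => birkhoff n F (wordCons n a y) :=
    (continuous_birkhoff n hF).comp hw
  have h1 := integral_le_relEnt (η := η.map (proj n)) (ν := Measure.pi fun _ : Fin n => p)
    hu.integrable_of_compactSpace hu.rexp.integrable_of_compactSpace
    (integral_exp_birkhoff_wordCons hF hn n y)
  rw [integral_map hproj.aemeasurable hu.aestronglyMeasurable] at h1
  have h2 : n * ∫ x, F x ∂η - (n * ε + K) ≤
      ∫ x, birkhoff n F (wordCons n (proj n x) y) ∂η := by
    rw [← integral_birkhoff hη hF]
    have hc : ∫ _ : ℕ → A, (n * ε + K) ∂η = n * ε + K := by simp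
    rw [← hc, ← integral_sub (continuous_birkhoff n hF).integrable_of_compactSpace
      (integrable_const _)]
    refine integral_mono
      ((continuous_birkhoff n hF).integrable_of_compactSpace.sub (integrable_const _))
      (hu.comp (continuous_proj n)).integrable_of_compactSpace fun x => ?_
    have := (abs_le.1 (hK n x (wordCons n (proj n x) y)
      fun i hi => (wordCons_proj_apply n x y hi).symm)).2
    dsimp only
    linarith
  rw [finEnt]
  refine (EReal.neg_le_neg_iff.2 h1).trans ?_
  rw [← EReal.coe_neg, EReal.coe_le_coe_iff]
  linarith

/-- A fixed point of the dual Ruelle operator of a normalized potential is shift-invariant. -/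
theorem map_shift_eq_of_integral_ruelle {p : Measure A} [IsProbabilityMeasure p]
    {F : (ℕ → A) → ℝ} (hn : ∀ x, ∫ a, Real.exp (F (cons a x)) ∂p = 1)
    {μ : Measure (ℕ → A)} [IsProbabilityMeasure μ]
    (hfix : ∀ φ : (ℕ → A) → ℝ, Continuous φ → ∫ x, ruelle p F φ x ∂μ = ∫ x, φ x ∂μ) :
    μ.map shift = μ := by
  have hs : Measurable (shift : (ℕ → A) → ℕ → A) := continuous_shift.measurable
  have : IsProbabilityMeasure (μ.map shift) := Measure.isProbabilityMeasure_map hs.aemeasurable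
  refine ext_of_forall_integral_eq_of_IsFiniteMeasure fun φ => ?_
  rw [integral_map hs.aemeasurable φ.continuous.aestronglyMeasurable,
    ← hfix (fun x => φ (shift x)) (φ.continuous.comp continuous_shift)]
  refine integral_congr_ae (ae_of_all _ fun x => ?_)
  simp only [ruelle, shift_cons]
  rw [integral_mul_const, hn, one_mul]

theorem integral_ruelle_iterate {p : Measure A} [IsProbabilityMeasure p]
    {F : (ℕ → A) → ℝ} (hF : Continuous F) {μ : Measure (ℕ → A)}
    (hfix : ∀ φ : (ℕ → A) → ℝ, Continuous φ → ∫ x, ruelle p F φ x ∂μ = ∫ x, φ x ∂μ)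
    (n : ℕ) {φ : (ℕ → A) → ℝ} (hφ : Continuous φ) :
    ∫ x, (ruelle p F)^[n] φ x ∂μ = ∫ x, φ x ∂μ := by
  induction n generalizing φ with
  | zero => rfl
  | succ n ih => rw [Function.iterate_succ_apply, ih (continuous_ruelle hF hφ), hfix φ hφ]

/-- The density of the `n`-dimensional marginal of a fixed point of the dual Ruelle operator. -/
def wordDensity (F : (ℕ → A) → ℝ) (μ : Measure (ℕ → A)) (n : ℕ) (a : Fin n → A) : ℝ :=
  ∫ y, Real.exp (birkhoff n F (wordCons n a y)) ∂μ

theorem continuous_exp_birkhoff_wordCons {F : (ℕ → A) → ℝ} (hF : Continuous F) (n : ℕ) :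
    Continuous fun q : (Fin n → A) × (ℕ → A) => Real.exp (birkhoff n F (wordCons n q.1 q.2)) :=
  ((continuous_birkhoff n hF).comp (continuous_wordCons n)).rexp

theorem continuous_wordDensity {F : (ℕ → A) → ℝ} (hF : Continuous F) (μ : Measure (ℕ → A))
    [IsProbabilityMeasure μ] (n : ℕ) : Continuous (wordDensity F μ n) :=
  Continuous.integral_of_compactSpace (continuous_exp_birkhoff_wordCons hF n)

theorem wordDensity_pos {F : (ℕ → A) → ℝ} (hF : Continuous F) (μ : Measure (ℕ → A))
    [IsProbabilityMeasure μ] (n : ℕ) (a : Fin n → A) : 0 < wordDensity F μ n a :=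
  integral_exp_pos ((continuous_exp_birkhoff_wordCons hF n).comp
    (continuous_const.prodMk continuous_id)).integrable_of_compactSpace

theorem integral_wordDensity_mul {p : Measure A} [IsProbabilityMeasure p]
    {F : (ℕ → A) → ℝ} (hF : Continuous F) {μ : Measure (ℕ → A)} [IsProbabilityMeasure μ]
    (hfix : ∀ φ : (ℕ → A) → ℝ, Continuous φ → ∫ x, ruelle p F φ x ∂μ = ∫ x, φ x ∂μ)
    (n : ℕ) {ψ : (Fin n → A) → ℝ} (hψ : Continuous ψ) :
    ∫ a, wordDensity F μ n a * ψ a ∂(Measure.pi fun _ : Fin n => p) =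
      ∫ x, ψ (proj n x) ∂μ := by
  have hψp : Continuous fun x => ψ (proj n x) := hψ.comp (continuous_proj n)
  rw [← integral_ruelle_iterate hF hfix n hψp]
  simp only [ruelle_iterate_apply hF hψp, proj_wordCons, wordDensity]
  simp only [← integral_mul_const]
  refine integral_integral_swap (f := fun a y =>
    Real.exp (birkhoff n F (wordCons n a y)) * ψ a) ?_
  exact ((continuous_exp_birkhoff_wordCons hF n).mul
    (hψ.comp continuous_fst)).integrable_of_compactSpace

/-- The fixed points of the dual Ruelle operator of a normalized potential attain equality in the
variational inequality. -/
theorem specEnt_eq_neg_integral {p : Measure A} [IsProbabilityMeasure p]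
    {F : (ℕ → A) → ℝ} (hF : Continuous F) (hn : ∀ x, ∫ a, Real.exp (F (cons a x)) ∂p = 1)
    {μ : Measure (ℕ → A)} [IsProbabilityMeasure μ]
    (hfix : ∀ φ : (ℕ → A) → ℝ, Continuous φ → ∫ x, ruelle p F φ x ∂μ = ∫ x, φ x ∂μ) :
    specEnt p μ = ((-∫ x, F x ∂μ : ℝ) : EReal) := by
  have hinv := map_shift_eq_of_integral_ruelle hn hfix
  refine le_antisymm (specEnt_le_neg_integral hF hn hinv)
    (le_specEnt_of_le_finEnt fun ε hε => ?_)
  obtain ⟨K, hK⟩ := exists_birkhoff_sub_le hF hε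
  refine ⟨K, fun n => ?_⟩
  have hproj : Measurable (proj n : (ℕ → A) → Fin n → A) := (continuous_proj n).measurable
  have : IsProbabilityMeasure (μ.map (proj n)) :=
    Measure.isProbabilityMeasure_map hproj.aemeasurable
  let ν : Measure (Fin n → A) := Measure.pi fun _ => p
  let u : (Fin n → A) → ℝ := fun a => Real.log (wordDensity F μ n a)
  have hu : Continuous u :=
    (continuous_wordDensity hF μ n).log fun a => (wordDensity_pos hF μ n a).ne'
  have hexp : ∀ a, Real.exp (u a) = wordDensity F μ n a := fun a =>
    Real.exp_log (wordDensity_pos hF μ n a)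
  have hint : Integrable (fun a => Real.exp (u a)) ν := hu.rexp.integrable_of_compactSpace
  have hone : ∫ a, Real.exp (u a) ∂ν = 1 := by
    simp only [hexp]
    simpa using integral_wordDensity_mul (p := p) hF hfix n (continuous_const (y := (1 : ℝ)))
  have : IsProbabilityMeasure (ν.tilted u) := isProbabilityMeasure_tilted hint
  have hmap : μ.map (proj n) = ν.tilted u := by
    refine ext_of_forall_integral_eq_of_IsFiniteMeasure fun ψ => ?_
    rw [integral_map hproj.aemeasurable ψ.continuous.aestronglyMeasurable, integral_tilted, hone]
    simp only [hexp, div_one, smul_eq_mul]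
    exact (integral_wordDensity_mul hF hfix n ψ.continuous).symm
  have hrel : relEnt (μ.map (proj n)) ν = ((∫ x, u (proj n x) ∂μ : ℝ) : EReal) := by
    rw [hmap, relEnt_tilted hint hone hu.integrable_of_compactSpace, ← hmap,
      integral_map hproj.aemeasurable hu.aestronglyMeasurable]
  have hle : ∫ x, u (proj n x) ∂μ ≤ n * ∫ x, F x ∂μ + (n * ε + K) := by
    rw [← integral_birkhoff hinv hF]
    have hc : ∫ _ : ℕ → A, (n * ε + K) ∂μ = n * ε + K := by simp
    rw [← hc, ← integral_add (continuous_birkhoff n hF).integrable_of_compactSpace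
      (integrable_const _)]
    refine integral_mono (hu.comp (continuous_proj n)).integrable_of_compactSpace
      ((continuous_birkhoff n hF).integrable_of_compactSpace.add (integrable_const _))
      fun x => ?_
    simp only [u]
    rw [Real.log_le_iff_le_exp (wordDensity_pos hF μ n _)]
    have hb : ∀ y, Real.exp (birkhoff n F (wordCons n (proj n x) y)) ≤
        Real.exp (birkhoff n F x + (n * ε + K)) := fun y => by
      have := (abs_le.1 (hK n x (wordCons n (proj n x) y)
        fun i hi => (wordCons_proj_apply n x y hi).symm)).1
      exact Real.exp_le_exp.2 (by linarith)
    have hi := integral_mono (μ := μ) ((continuous_exp_birkhoff_wordCons hF n).comp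
      (continuous_const (y := proj n x)|>.prodMk continuous_id)).integrable_of_compactSpace
      (integrable_const _) hb
    simpa [wordDensity] using hi
  rw [finEnt, hrel, ← EReal.coe_neg, EReal.coe_le_coe_iff]
  linarith

/-- One-sided first-order consequence of the variational inequality at an equilibrium state. -/
theorem integral_le_integral_ruelle {p : Measure A} [IsProbabilityMeasure p]
    {F : (ℕ → A) → ℝ} (hF : Continuous F) (hn : ∀ x, ∫ a, Real.exp (F (cons a x)) ∂p = 1)
    {η : Measure (ℕ → A)} [IsProbabilityMeasure η] (hη : η.map shift = η)
    (heq : specEnt p η = ((-∫ x, F x ∂η : ℝ) : EReal)) {φ : (ℕ → A) → ℝ} (hφ : Continuous φ) :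
    ∫ x, φ x ∂η ≤ ∫ x, ruelle p F φ x ∂η := by
  obtain ⟨M, hM0, hM⟩ := exists_bound hφ
  have hLc : Continuous (ruelle p F φ) := continuous_ruelle hF hφ
  have key : ∀ t : ℝ, 0 < t → t * M ≤ 1 →
      ∫ x, φ x ∂η ≤ ∫ x, ruelle p F φ x ∂η + t * M ^ 2 := by
    intro t ht htM
    let Z : (ℕ → A) → ℝ := ruelle p F fun x => Real.exp (t * φ x)
    have hZc : Continuous Z := continuous_ruelle hF (hφ.const_mul t).rexp
    have hcons : ∀ x : ℕ → A, Continuous fun a => cons a x := fun x =>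
      continuous_cons.comp (continuous_id.prodMk (continuous_const (y := x)))
    have hZpos : ∀ x, 0 < Z x := fun x => by
      simp only [Z, ruelle, ← Real.exp_add]
      exact integral_exp_pos (((hF.comp (hcons x)).add
        ((hφ.comp (hcons x)).const_mul t)).rexp.integrable_of_compactSpace)
    have hlogZ : Continuous fun x => Real.log (Z x) := hZc.log fun x => (hZpos x).ne'
    let G : (ℕ → A) → ℝ := fun x => F x + t * φ x - Real.log (Z (shift x))
    have hlogZs : Continuous fun x => Real.log (Z (shift x)) := hlogZ.comp continuous_shift
    have hFφ : Continuous fun x => F x + t * φ x := hF.add (hφ.const_mul t)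
    have hG : Continuous G := hFφ.sub hlogZs
    have hGn : ∀ x, ∫ a, Real.exp (G (cons a x)) ∂p = 1 := fun x => by
      simp only [G, shift_cons, Real.exp_sub, Real.exp_add, Real.exp_log (hZpos x)]
      rw [integral_div]
      exact div_self (hZpos x).ne'
    have h1 := specEnt_le_neg_integral hG hGn hη
    rw [heq, EReal.coe_le_coe_iff] at h1
    have h2 : ∫ x, Real.log (Z (shift x)) ∂η = ∫ x, Real.log (Z x) ∂η := by
      conv_rhs => rw [← hη]
      exact (integral_map continuous_shift.measurable.aemeasurable
        hlogZ.aestronglyMeasurable).symm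
    have h3 : ∫ x, G x ∂η = ∫ x, F x ∂η + t * ∫ x, φ x ∂η - ∫ x, Real.log (Z x) ∂η := by
      rw [← h2, ← integral_const_mul, ← integral_add hF.integrable_of_compactSpace
        (hφ.const_mul t).integrable_of_compactSpace, ← integral_sub
        hFφ.integrable_of_compactSpace hlogZs.integrable_of_compactSpace]
    have hZle : ∀ x, Z x ≤ 1 + (t * ruelle p F φ x + (t * M) ^ 2) := fun x => by
      have hi1 : Integrable (fun a => Real.exp (F (cons a x))) p :=
        (hF.comp (hcons x)).rexp.integrable_of_compactSpace
      have hi2 : Integrable (fun a => Real.exp (F (cons a x)) * φ (cons a x)) p :=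
        ((hF.comp (hcons x)).rexp.mul (hφ.comp (hcons x))).integrable_of_compactSpace
      have hrhs : 1 + (t * ruelle p F φ x + (t * M) ^ 2) =
          ∫ a, (Real.exp (F (cons a x)) * (1 + (t * M) ^ 2) +
            t * (Real.exp (F (cons a x)) * φ (cons a x))) ∂p := by
        rw [integral_add (hi1.mul_const _) (hi2.const_mul _), integral_mul_const,
          integral_const_mul, hn]
        simp only [ruelle]
        ring
      rw [hrhs]
      refine integral_mono ((hF.comp (hcons x)).rexp.mul
        ((hφ.comp (hcons x)).const_mul t).rexp).integrable_of_compactSpace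
        ((hi1.mul_const _).add (hi2.const_mul _)) fun a => ?_
      have habs : |t * φ (cons a x)| ≤ t * M := by
        rw [abs_mul, abs_of_pos ht]
        exact mul_le_mul_of_nonneg_left (hM _) ht.le
      have hexp : Real.exp (t * φ (cons a x)) ≤ 1 + t * φ (cons a x) + (t * M) ^ 2 := by
        have e1 := (abs_le.1 (Real.abs_exp_sub_one_sub_id_le (habs.trans htM))).2
        have e2 : (t * φ (cons a x)) ^ 2 ≤ (t * M) ^ 2 :=
          sq_le_sq' (abs_le.1 habs).1 (abs_le.1 habs).2
        linarith
      have := mul_le_mul_of_nonneg_left hexp (Real.exp_pos (F (cons a x))).le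
      dsimp only
      linarith
    have h4 : ∫ x, Real.log (Z x) ∂η ≤ t * ∫ x, ruelle p F φ x ∂η + (t * M) ^ 2 := by
      have hc : ∫ _ : ℕ → A, (t * M) ^ 2 ∂η = (t * M) ^ 2 := by simp
      rw [← integral_const_mul, ← hc, ← integral_add
        (hLc.const_mul t).integrable_of_compactSpace (integrable_const _)]
      refine integral_mono hlogZ.integrable_of_compactSpace
        ((hLc.const_mul t).integrable_of_compactSpace.add (integrable_const _)) fun x => ?_
      have := Real.log_le_sub_one_of_pos (hZpos x)
      have := hZle x
      simp only
      linarith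
    have h5 : t * ∫ x, φ x ∂η ≤ t * (∫ x, ruelle p F φ x ∂η + t * M ^ 2) := by
      nlinarith
    exact le_of_mul_le_mul_left h5 ht
  have hlim : Tendsto (fun t : ℝ => ∫ x, ruelle p F φ x ∂η + t * M ^ 2) (nhdsWithin 0 (Set.Ioi 0))
      (nhds (∫ x, ruelle p F φ x ∂η)) := by
    have hc : Continuous fun t : ℝ => ∫ x, ruelle p F φ x ∂η + t * M ^ 2 := by fun_prop
    have := (hc.tendsto 0).mono_left (nhdsWithin_le_nhds (s := Set.Ioi 0))
    simpa using this
  have hsmall : ∀ᶠ t : ℝ in nhdsWithin 0 (Set.Ioi 0), t * M ≤ 1 := by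
    have hc : Continuous fun t : ℝ => t * M := by fun_prop
    refine nhdsWithin_le_nhds ((hc.tendsto 0).eventually_le_const ?_)
    simp
  refine ge_of_tendsto hlim ?_
  filter_upwards [self_mem_nhdsWithin, hsmall] with t ht htM using key t ht htM

theorem integral_ruelle_eq_of_specEnt_eq {p : Measure A} [IsProbabilityMeasure p]
    {F : (ℕ → A) → ℝ} (hF : Continuous F) (hn : ∀ x, ∫ a, Real.exp (F (cons a x)) ∂p = 1)
    {η : Measure (ℕ → A)} [IsProbabilityMeasure η] (hη : η.map shift = η)
    (heq : specEnt p η = ((-∫ x, F x ∂η : ℝ) : EReal)) {φ : (ℕ → A) → ℝ} (hφ : Continuous φ) :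
    ∫ x, ruelle p F φ x ∂η = ∫ x, φ x ∂η := by
  refine le_antisymm ?_ (integral_le_integral_ruelle hF hn hη heq hφ)
  have h1 := integral_le_integral_ruelle hF hn hη heq hφ.neg
  have h2 : ruelle p F (-φ) = fun x => -ruelle p F φ x := by
    ext x
    simp [ruelle, integral_neg]
  rw [h2] at h1
  simp only [Pi.neg_apply, integral_neg] at h1
  linarith

theorem continuous_fbar {f h : (ℕ → A) → ℝ} {lam : ℝ} (hf : Continuous f) (hh : Continuous h)
    (hpos : ∀ x, 0 < h x) : Continuous (fbar f h lam) := by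
  have hl : Continuous fun x => Real.log (h x) := hh.log fun x => (hpos x).ne'
  exact ((hf.add hl).sub (hl.comp continuous_shift)).sub continuous_const

theorem integral_exp_fbar_cons {p : Measure A} {f h : (ℕ → A) → ℝ} {lam : ℝ} (hlam : 0 < lam)
    (hpos : ∀ x, 0 < h x) (heig : ∀ x, ruelle p f h x = lam * h x) (x : ℕ → A) :
    ∫ a, Real.exp (fbar f h lam (cons a x)) ∂p = 1 := by
  simp only [fbar, shift_cons, Real.exp_sub, Real.exp_add, Real.exp_log (hpos _),
    Real.exp_log hlam]
  rw [integral_div, integral_div]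
  have := heig x
  rw [ruelle] at this
  rw [this]
  have := (hpos x).ne'
  field_simp

theorem integral_fbar {f h : (ℕ → A) → ℝ} {lam : ℝ} (hf : Continuous f) (hh : Continuous h)
    (hpos : ∀ x, 0 < h x) {η : Measure (ℕ → A)} [IsProbabilityMeasure η]
    (hη : η.map shift = η) :
    ∫ x, fbar f h lam x ∂η = ∫ x, f x ∂η - Real.log lam := by
  have hl : Continuous fun x => Real.log (h x) := hh.log fun x => (hpos x).ne'
  have hls : Continuous fun x => Real.log (h (shift x)) := hl.comp continuous_shift
  have h2 : ∫ x, Real.log (h (shift x)) ∂η = ∫ x, Real.log (h x) ∂η := by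
    conv_rhs => rw [← hη]
    exact (integral_map continuous_shift.measurable.aemeasurable hl.aestronglyMeasurable).symm
  simp only [fbar]
  have hfl : Continuous fun x => f x + Real.log (h x) := hf.add hl
  have hfls : Continuous fun x => f x + Real.log (h x) - Real.log (h (shift x)) := hfl.sub hls
  rw [integral_sub hfls.integrable_of_compactSpace (integrable_const _),
    integral_sub hfl.integrable_of_compactSpace hls.integrable_of_compactSpace,
    integral_add hf.integrable_of_compactSpace hl.integrable_of_compactSpace, h2]
  simp

/-- For an `α`-Hölder potential `f` with eigendata `(λ, h)` and `μ_f̄` the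
unique Borel probability measure fixed by the transpose of `L_{f̄}`, `μ_f̄` is the unique
equilibrium state for `f`: it is shift-invariant, it attains the supremum of
`h^s(η) + ∫ f dη` over shift-invariant Borel probability measures `η`, this supremum
equals `log λ`, and any shift-invariant attainer equals `μ_f̄`. -/
theorem statement4
    (p : Measure A) [IsProbabilityMeasure p]
    (hsupp : ∀ U : Set A, IsOpen U → U.Nonempty → 0 < p U)
    (α : ℝ) (hα0 : 0 < α) (hα1 : α < 1)
    (f : (ℕ → A) → ℝ) (hf : IsHolder α f)
    (lam : ℝ) (hlam : 0 < lam)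
    (h : (ℕ → A) → ℝ) (hh : IsHolder α h) (hpos : ∀ x, 0 < h x)
    (heig : ∀ x, ruelle p f h x = lam * h x)
    (μf : Measure (ℕ → A)) [IsProbabilityMeasure μf]
    (hfix : ∀ φ : (ℕ → A) → ℝ, Continuous φ →
      ∫ x, ruelle p (fbar f h lam) φ x ∂μf = ∫ x, φ x ∂μf)
    (huniq : ∀ ν : Measure (ℕ → A), IsProbabilityMeasure ν →
      (∀ φ : (ℕ → A) → ℝ, Continuous φ →
        ∫ x, ruelle p (fbar f h lam) φ x ∂ν = ∫ x, φ x ∂ν) → ν = μf) :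
    μf.map shift = μf
    ∧ specEnt p μf + ((∫ x, f x ∂μf : ℝ) : EReal) = ((Real.log lam : ℝ) : EReal)
    ∧ (∀ η : Measure (ℕ → A), IsProbabilityMeasure η → η.map shift = η →
        specEnt p η + ((∫ x, f x ∂η : ℝ) : EReal) ≤ ((Real.log lam : ℝ) : EReal))
    ∧ (∀ η : Measure (ℕ → A), IsProbabilityMeasure η → η.map shift = η →
        specEnt p η + ((∫ x, f x ∂η : ℝ) : EReal) = ((Real.log lam : ℝ) : EReal) →
        η = μf) := by
  have hfc := hf.continuous hα0
  have hhc := hh.continuous hα0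
  have hF : Continuous (fbar f h lam) := continuous_fbar hfc hhc hpos
  have hn := integral_exp_fbar_cons hlam hpos heig
  have hinv := map_shift_eq_of_integral_ruelle hn hfix
  have hadd : ∀ η : Measure (ℕ → A), IsProbabilityMeasure η → η.map shift = η →
      ((-∫ x, fbar f h lam x ∂η : ℝ) : EReal) + ((∫ x, f x ∂η : ℝ) : EReal) =
        ((Real.log lam : ℝ) : EReal) := fun η _ hη => by
    rw [integral_fbar hfc hhc hpos hη, ← EReal.coe_add]
    congr 1
    ring
  refine ⟨hinv, ?_, fun η hη hηinv => ?_, fun η hη hηinv heq => ?_⟩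
  · rw [specEnt_eq_neg_integral hF hn hfix, hadd μf inferInstance hinv]
  · rw [← hadd η hη hηinv]
    gcongr
    exact specEnt_le_neg_integral hF hn hηinv
  · refine huniq η hη fun φ hφ => integral_ruelle_eq_of_specEnt_eq hF hn hηinv ?_ hφ
    rw [← hadd η hη hηinv] at heq
    have := congrArg (· - ((∫ x, f x ∂η : ℝ) : EReal)) heq
    simpa only [EReal.add_sub_cancel_right] using this

end Paper
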